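/- In the randomize-first-sample-second design with pre-treatment sampling, the gain-score estimator τ̂* = (ȳ(1) - x̄(1)) - (ȳ(0) - x̄(0)) is unbiased for τ and has sampling variance Var(τ̂*) = Var(τ̂) + (1/n_{x_1} + 1/n_{x_0})·S_x² - 2(S_{1x}/N_1 + S_{0x}/N_0), where Var(τ̂) = S_1²/n_1 + S_0²/n_0 - S_τ²/N. -/

import Mathlib

open Finset

/-- Expectation under the uniform distribution on a finite sample space. -/
noncomputable def Ex {α : Type*} (Ω : Finset α) (f : α → ℝ) : ℝ :=
  (∑ ω ∈ Ω, f ω) / (Ω.card : ℝ)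

/-- The randomize-first-sample-second design with pre-treatment sampling:
outcomes are tuples `(A, B, C, Bx, Cx)` where `A` is the treatment-1 group of
size `N₁` (its complement is group 0), and, conditionally on `A`, the four
samples are independent and uniform: `B ⊆ A` of size `n₁` (post-treatment,
arm 1), `C ⊆ Aᶜ` of size `n₀` (post-treatment, arm 0), `Bx ⊆ A` of size
`nx₁` (pre-treatment, arm 1), `Cx ⊆ Aᶜ` of size `nx₀` (pre-treatment, arm 0).
The uniform distribution over all such tuples coincides with this two-stage
scheme. -/
def design3 (N N1 n1 n0 nx1 nx0 : ℕ) :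
    Finset (Finset (Fin N) × Finset (Fin N) × Finset (Fin N) ×
      Finset (Fin N) × Finset (Fin N)) :=
  Finset.univ.filter (fun p =>
    p.1.card = N1 ∧
    p.2.1 ⊆ p.1 ∧ p.2.1.card = n1 ∧
    p.2.2.1 ⊆ p.1ᶜ ∧ p.2.2.1.card = n0 ∧
    p.2.2.2.1 ⊆ p.1 ∧ p.2.2.2.1.card = nx1 ∧
    p.2.2.2.2 ⊆ p.1ᶜ ∧ p.2.2.2.2.card = nx0)

/-- Post-treatment sampling indicator for arm 1: `i ∈ B`. -/
def S1 {N : ℕ} (i : Fin N)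
    (p : Finset (Fin N) × Finset (Fin N) × Finset (Fin N) ×
      Finset (Fin N) × Finset (Fin N)) : ℝ :=
  if i ∈ p.2.1 then 1 else 0

/-- Post-treatment sampling indicator for arm 0: `i ∈ C`. -/
def S0 {N : ℕ} (i : Fin N)
    (p : Finset (Fin N) × Finset (Fin N) × Finset (Fin N) ×
      Finset (Fin N) × Finset (Fin N)) : ℝ :=
  if i ∈ p.2.2.1 then 1 else 0

/-- Pre-treatment sampling indicator for arm 1: `i ∈ Bx`. -/
def Z1 {N : ℕ} (i : Fin N)
    (p : Finset (Fin N) × Finset (Fin N) × Finset (Fin N) ×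
      Finset (Fin N) × Finset (Fin N)) : ℝ :=
  if i ∈ p.2.2.2.1 then 1 else 0

/-- Pre-treatment sampling indicator for arm 0: `i ∈ Cx`. -/
def Z0 {N : ℕ} (i : Fin N)
    (p : Finset (Fin N) × Finset (Fin N) × Finset (Fin N) ×
      Finset (Fin N) × Finset (Fin N)) : ℝ :=
  if i ∈ p.2.2.2.2 then 1 else 0


lemma Ex_add {α : Type*} (Ω : Finset α) (f g : α → ℝ) :
    Ex Ω (fun x => f x + g x) = Ex Ω f + Ex Ω g := by
  unfold Ex; rw [sum_add_distrib, add_div]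

lemma Ex_sub {α : Type*} (Ω : Finset α) (f g : α → ℝ) :
    Ex Ω (fun x => f x - g x) = Ex Ω f - Ex Ω g := by
  unfold Ex; rw [sum_sub_distrib, sub_div]

lemma Ex_mul_left {α : Type*} (Ω : Finset α) (c : ℝ) (f : α → ℝ) :
    Ex Ω (fun x => c * f x) = c * Ex Ω f := by
  unfold Ex; rw [← mul_sum, mul_div_assoc]

lemma Ex_mul_right {α : Type*} (Ω : Finset α) (c : ℝ) (f : α → ℝ) :
    Ex Ω (fun x => f x * c) = Ex Ω f * c := by
  unfold Ex; rw [← sum_mul]; ring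

lemma Ex_div {α : Type*} (Ω : Finset α) (c : ℝ) (f : α → ℝ) :
    Ex Ω (fun x => f x / c) = Ex Ω f / c := by
  simp only [div_eq_mul_inv, Ex_mul_right]

lemma Ex_const {α : Type*} (Ω : Finset α) (h : Ω.Nonempty) (c : ℝ) :
    Ex Ω (fun _ => c) = c := by
  have : (Ω.card : ℝ) ≠ 0 := by exact_mod_cast h.card_pos.ne'
  unfold Ex; rw [sum_const, nsmul_eq_mul]; field_simp

lemma Ex_congr {α : Type*} (Ω : Finset α) {f g : α → ℝ} (h : ∀ x ∈ Ω, f x = g x) :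
    Ex Ω f = Ex Ω g := by
  unfold Ex; rw [sum_congr rfl h]

lemma Ex_sum {α β : Type*} (Ω : Finset α) (s : Finset β) (f : β → α → ℝ) :
    Ex Ω (fun x => ∑ i ∈ s, f i x) = ∑ i ∈ s, Ex Ω (f i) := by
  unfold Ex; rw [sum_comm, sum_div]

lemma Ex_incl {α : Type*} [DecidableEq α] (s : Finset α) (k : ℕ) (hk : 1 ≤ k) (hks : k ≤ s.card)
    (i : α) (hi : i ∈ s) :
    Ex (powersetCard k s) (fun B => if i ∈ B then (1 : ℝ) else 0) = (k : ℝ) / s.card := by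
  have hc := card_filter_powersetCard_subset {i} s k (by simpa using hi)
    (by simpa using hk)
  simp only [singleton_subset_iff, card_singleton] at hc
  unfold Ex
  rw [sum_boole, hc, card_powersetCard]
  obtain ⟨k, rfl⟩ : ∃ k', k = k' + 1 := ⟨k - 1, by omega⟩
  obtain ⟨n, hn⟩ : ∃ n, s.card = n + 1 := ⟨s.card - 1, by omega⟩
  rw [hn] at hks ⊢
  have h1 := Nat.add_one_mul_choose_eq n k
  have h2 : 0 < (n + 1).choose (k + 1) := Nat.choose_pos hks
  have h1' : ((n : ℝ) + 1) * (n.choose k : ℝ) = ((n + 1).choose (k + 1) : ℝ) * (k + 1) := by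
    exact_mod_cast h1
  have h2' : ((n + 1).choose (k + 1) : ℝ) ≠ 0 := by exact_mod_cast h2.ne'
  have h3 : (n : ℝ) + 1 ≠ 0 := by positivity
  simp only [Nat.add_sub_cancel]
  push_cast
  field_simp
  linarith

lemma Ex_incl2 {α : Type*} [DecidableEq α] (s : Finset α) (k : ℕ) (hk : 1 ≤ k) (hks : k ≤ s.card)
    (i j : α) (hi : i ∈ s) (hj : j ∈ s) (hij : i ≠ j) :
    Ex (powersetCard k s) (fun B => if i ∈ B ∧ j ∈ B then (1 : ℝ) else 0)
      = ((k : ℝ) * (k - 1)) / (s.card * (s.card - 1)) := by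
  have hcard : ({i, j} : Finset α).card = 2 := card_pair hij
  have hsub : ({i, j} : Finset α) ⊆ s := by
    intro x hx; simp only [mem_insert, mem_singleton] at hx
    rcases hx with rfl | rfl <;> assumption
  have h2s : 2 ≤ s.card := hcard ▸ card_le_card hsub
  rcases Nat.lt_or_ge k 2 with hk2 | hk2
  · obtain rfl : k = 1 := by omega
    have : ∀ B ∈ powersetCard 1 s, (if i ∈ B ∧ j ∈ B then (1 : ℝ) else 0) = 0 := by
      intro B hB
      rw [if_neg]
      rintro ⟨h1, h2⟩
      exact hij (card_le_one.1 (mem_powersetCard.1 hB).2.le i h1 j h2)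
    rw [Ex_congr _ this]
    simp [Ex]
  have hc := card_filter_powersetCard_subset {i, j} s k hsub (by omega)
  have hiff : ∀ B : Finset α, ({i, j} : Finset α) ⊆ B ↔ (i ∈ B ∧ j ∈ B) := by
    intro B; simp [insert_subset_iff]
  simp only [hiff, hcard] at hc
  unfold Ex
  rw [sum_boole, hc, card_powersetCard]
  obtain ⟨k, rfl⟩ : ∃ k', k = k' + 2 := ⟨k - 2, by omega⟩
  obtain ⟨n, hn⟩ : ∃ n, s.card = n + 2 := ⟨s.card - 2, by omega⟩
  rw [hn] at hks ⊢
  have h1 := Nat.add_one_mul_choose_eq n k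
  have h0 := Nat.add_one_mul_choose_eq (n + 1) (k + 1)
  have h2 : 0 < (n + 2).choose (k + 2) := Nat.choose_pos hks
  have h1' : ((n : ℝ) + 1) * (n.choose k : ℝ) = ((n + 1).choose (k + 1) : ℝ) * (k + 1) := by
    exact_mod_cast h1
  have h0' : ((n : ℝ) + 1 + 1) * ((n + 1).choose (k + 1) : ℝ)
      = ((n + 2).choose (k + 2) : ℝ) * (k + 1 + 1) := by
    exact_mod_cast h0
  have h2' : ((n + 2).choose (k + 2) : ℝ) ≠ 0 := by exact_mod_cast h2.ne'
  have h3 : (n : ℝ) + 1 ≠ 0 := by positivity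
  have h4 : (n : ℝ) + 2 ≠ 0 := by positivity
  simp only [Nat.add_sub_cancel]
  push_cast
  have e1 : (n : ℝ) + 2 - 1 = n + 1 := by ring
  have e2 : (k : ℝ) + 2 - 1 = k + 1 := by ring
  rw [e1, e2, div_eq_div_iff h2' (by positivity)]
  linear_combination ((n : ℝ) + 2) * h1' + ((k : ℝ) + 1) * h0'

lemma Ex_S {α : Type*} [DecidableEq α] (s : Finset α) (k : ℕ) (hk : 1 ≤ k) (hks : k ≤ s.card)
    (f : α → ℝ) :
    Ex (powersetCard k s) (fun B => ∑ i ∈ B, f i) = (k : ℝ) / s.card * ∑ i ∈ s, f i := by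
  have : ∀ B ∈ powersetCard k s, ∑ i ∈ B, f i
      = ∑ i ∈ s, f i * (if i ∈ B then (1 : ℝ) else 0) := by
    intro B hB
    have hs := (mem_powersetCard.1 hB).1
    simp only [mul_ite, mul_one, mul_zero]
    rw [← sum_filter, filter_mem_eq_inter, inter_eq_right.2 hs]
  rw [Ex_congr _ this, Ex_sum, mul_sum]
  refine sum_congr rfl fun i hi => ?_
  rw [Ex_mul_left, Ex_incl s k hk hks i hi, mul_comm]

lemma Ex_SS {α : Type*} [DecidableEq α] (s : Finset α) (k : ℕ) (hk : 1 ≤ k) (hks : k ≤ s.card)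
    (f g : α → ℝ) :
    Ex (powersetCard k s) (fun B => (∑ i ∈ B, f i) * (∑ i ∈ B, g i))
      = (k : ℝ) / s.card * ∑ i ∈ s, f i * g i
        + ((k : ℝ) * (k - 1)) / (s.card * (s.card - 1))
          * ((∑ i ∈ s, f i) * (∑ i ∈ s, g i) - ∑ i ∈ s, f i * g i) := by
  have : ∀ B ∈ powersetCard k s, (∑ i ∈ B, f i) * (∑ i ∈ B, g i)
      = ∑ i ∈ s, ∑ j ∈ s, (f i * g j) * (if i ∈ B ∧ j ∈ B then (1 : ℝ) else 0) := by
    intro B hB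
    have hs := (mem_powersetCard.1 hB).1
    have key : ∀ f : α → ℝ, ∑ i ∈ B, f i = ∑ i ∈ s, f i * (if i ∈ B then (1 : ℝ) else 0) := by
      intro f
      simp only [mul_ite, mul_one, mul_zero]
      rw [← sum_filter, filter_mem_eq_inter, inter_eq_right.2 hs]
    rw [key f, key g, sum_mul_sum]
    refine sum_congr rfl fun i _ => sum_congr rfl fun j _ => ?_
    by_cases h1 : i ∈ B <;> by_cases h2 : j ∈ B <;> simp [h1, h2]
  rw [Ex_congr _ this, Ex_sum]
  set P := (k : ℝ) / s.card
  set R := ((k : ℝ) * (k - 1)) / (s.card * (s.card - 1))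
  have h2 : ∀ i ∈ s, Ex (powersetCard k s)
      (fun B => ∑ j ∈ s, (f i * g j) * (if i ∈ B ∧ j ∈ B then (1 : ℝ) else 0))
      = R * (f i * ∑ j ∈ s, g j) + (P - R) * (f i * g i) := by
    intro i hi
    rw [Ex_sum]
    have h3 : ∀ j ∈ s, Ex (powersetCard k s)
        (fun B => (f i * g j) * (if i ∈ B ∧ j ∈ B then (1 : ℝ) else 0))
        = R * (f i * g j) + (if i = j then (P - R) * (f i * g j) else 0) := by
      intro j hj
      rw [Ex_mul_left]
      by_cases hij : i = j
      · subst hij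
        simp only [and_self, if_true]
        rw [Ex_incl s k hk hks i hi]; ring
      · rw [Ex_incl2 s k hk hks i j hi hj hij, if_neg hij]; ring
    rw [sum_congr rfl h3, sum_add_distrib, sum_ite_eq, if_pos hi, mul_sum, mul_sum]
  rw [sum_congr rfl h2, sum_add_distrib, ← mul_sum, ← mul_sum, ← sum_mul]
  ring

lemma Ex_four {α : Type*} (P Q R S : Finset α) (hP : P.Nonempty) (hQ : Q.Nonempty)
    (hR : R.Nonempty) (hS : S.Nonempty) (a b c d : α → ℝ) :
    Ex P (fun B => Ex Q (fun C => Ex R (fun Bx => Ex S (fun Cx =>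
      (a B - b Bx) - (c C - d Cx))))) = (Ex P a - Ex R b) - (Ex Q c - Ex S d) := by
  simp only [Ex_sub, Ex_const _ hP, Ex_const _ hQ, Ex_const _ hR, Ex_const _ hS]

lemma Ex_four_sq {α : Type*} (P Q R S : Finset α) (hP : P.Nonempty) (hQ : Q.Nonempty)
    (hR : R.Nonempty) (hS : S.Nonempty) (a b c d : α → ℝ) :
    Ex P (fun B => Ex Q (fun C => Ex R (fun Bx => Ex S (fun Cx =>
      ((a B - b Bx) - (c C - d Cx)) ^ 2)))) =
      Ex P (fun B => a B * a B) + Ex R (fun B => b B * b B) + Ex Q (fun B => c B * c B)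
      + Ex S (fun B => d B * d B)
      - 2 * (Ex P a * Ex R b) - 2 * (Ex P a * Ex Q c) + 2 * (Ex P a * Ex S d)
      + 2 * (Ex R b * Ex Q c) - 2 * (Ex R b * Ex S d) - 2 * (Ex Q c * Ex S d) := by
  have e : ∀ B C Bx Cx, ((a B - b Bx) - (c C - d Cx)) ^ 2
     = a B * a B + b Bx * b Bx + c C * c C + d Cx * d Cx
      - 2 * (a B * b Bx) - 2 * (a B * c C) + 2 * (a B * d Cx)
      + 2 * (b Bx * c C) - 2 * (c C * d Cx) - 2 * (b Bx * d Cx) := by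
    intros; ring
  simp only [e, Ex_sub, Ex_add, Ex_mul_left, Ex_mul_right,
    Ex_const _ hP, Ex_const _ hQ, Ex_const _ hR, Ex_const _ hS]
  ring

lemma sum_design3 (N N1 n1 n0 nx1 nx0 : ℕ)
    (F : Finset (Fin N) × Finset (Fin N) × Finset (Fin N) ×
      Finset (Fin N) × Finset (Fin N) → ℝ) :
    ∑ p ∈ design3 N N1 n1 n0 nx1 nx0, F p =
      ∑ A ∈ powersetCard N1 univ, ∑ B ∈ powersetCard n1 A, ∑ C ∈ powersetCard n0 Aᶜ,
        ∑ Bx ∈ powersetCard nx1 A, ∑ Cx ∈ powersetCard nx0 Aᶜ, F (A, B, C, Bx, Cx) := by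
  rw [sum_finset_product (design3 N N1 n1 n0 nx1 nx0) (powersetCard N1 univ)
    (fun A => powersetCard n1 A ×ˢ powersetCard n0 Aᶜ ×ˢ powersetCard nx1 A ×ˢ powersetCard nx0 Aᶜ)]
  · simp only [sum_product]
  · rintro ⟨A, B, C, Bx, Cx⟩
    simp only [design3, mem_filter, mem_univ, true_and, mem_product, mem_powersetCard,
      subset_univ]
    tauto

lemma Ex_design3 (N N1 n1 n0 nx1 nx0 : ℕ)
    (F : Finset (Fin N) × Finset (Fin N) × Finset (Fin N) ×
      Finset (Fin N) × Finset (Fin N) → ℝ) :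
    Ex (design3 N N1 n1 n0 nx1 nx0) F =
      Ex (powersetCard N1 univ) (fun A => Ex (powersetCard n1 A) (fun B =>
        Ex (powersetCard n0 Aᶜ) (fun C => Ex (powersetCard nx1 A) (fun Bx =>
          Ex (powersetCard nx0 Aᶜ) (fun Cx => F (A, B, C, Bx, Cx)))))) := by
  have hc : ((design3 N N1 n1 n0 nx1 nx0).card : ℝ) = (N.choose N1 : ℝ) *
      ((N1.choose n1 : ℝ) * ((N - N1).choose n0 * (N1.choose nx1 * (N - N1).choose nx0))) := by
    have := sum_design3 N N1 n1 n0 nx1 nx0 (fun _ => 1)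
    rw [sum_const, nsmul_eq_mul, mul_one] at this
    rw [this]
    have h2 : ∀ A ∈ powersetCard N1 (univ : Finset (Fin N)),
        (∑ B ∈ powersetCard n1 A, ∑ C ∈ powersetCard n0 Aᶜ,
        ∑ Bx ∈ powersetCard nx1 A, ∑ Cx ∈ powersetCard nx0 Aᶜ, (1 : ℝ))
        = ((N1.choose n1 : ℝ) * ((N - N1).choose n0 * (N1.choose nx1 * (N - N1).choose nx0))) := by
      intro A hA
      have hA := (mem_powersetCard.1 hA).2
      simp only [sum_const, card_powersetCard, card_compl, hA, Fintype.card_fin, nsmul_eq_mul,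
        mul_one]
    rw [sum_congr rfl h2]
    simp only [sum_const, card_powersetCard, card_univ, Fintype.card_fin, nsmul_eq_mul]
  have hin : ∀ A ∈ powersetCard N1 (univ : Finset (Fin N)),
      Ex (powersetCard n1 A) (fun B =>
        Ex (powersetCard n0 Aᶜ) (fun C => Ex (powersetCard nx1 A) (fun Bx =>
          Ex (powersetCard nx0 Aᶜ) (fun Cx => F (A, B, C, Bx, Cx)))))
      = (∑ B ∈ powersetCard n1 A, ∑ C ∈ powersetCard n0 Aᶜ,
        ∑ Bx ∈ powersetCard nx1 A, ∑ Cx ∈ powersetCard nx0 Aᶜ, F (A, B, C, Bx, Cx)) /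
        ((N1.choose n1 : ℝ) * ((N - N1).choose n0 * (N1.choose nx1 * (N - N1).choose nx0))) := by
    intro A hA
    have hA := (mem_powersetCard.1 hA).2
    simp only [Ex, card_powersetCard, card_compl, hA, Fintype.card_fin, ← sum_div, div_div]
    congr 1; ring
  rw [Ex_congr _ hin]
  rw [Ex_div]
  unfold Ex
  rw [hc, sum_design3, div_div, card_powersetCard, card_univ, Fintype.card_fin]

lemma two_stage (N N1 M k : ℕ) (hN : 2 ≤ N) (hM : 1 ≤ M)
    (hk : 1 ≤ k) (hkM : k ≤ M) (Q : ℝ) (f : Fin N → ℝ)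
    (s : Finset (Fin N) → Finset (Fin N))
    (hs : ∀ A ∈ powersetCard N1 univ, (s A).card = M)
    (h1 : Ex (powersetCard N1 univ) (fun A => ∑ i ∈ s A, f i * f i) = (M : ℝ) / N * Q)
    (h2 : Ex (powersetCard N1 univ) (fun A => (∑ i ∈ s A, f i) * (∑ i ∈ s A, f i))
      = (M : ℝ) * (N - M) / (N * (N - 1)) * Q) :
    Ex (powersetCard N1 univ) (fun A => Ex (powersetCard k (s A))
      (fun B => ((∑ i ∈ B, f i) / (k : ℝ)) * ((∑ i ∈ B, f i) / (k : ℝ))))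
      = (1 / (k : ℝ) - 1 / N) * (Q / (N - 1)) := by
  have hin : ∀ A ∈ powersetCard N1 (univ : Finset (Fin N)), Ex (powersetCard k (s A))
      (fun B => ((∑ i ∈ B, f i) / (k : ℝ)) * ((∑ i ∈ B, f i) / (k : ℝ)))
      = ((k : ℝ) / M * (∑ i ∈ s A, f i * f i)
        + ((k : ℝ) * (k - 1)) / (M * (M - 1))
          * ((∑ i ∈ s A, f i) * (∑ i ∈ s A, f i) - ∑ i ∈ s A, f i * f i)) / (k * k) := by
    intro A hA
    have := Ex_SS (s A) k hk (by rw [hs A hA]; exact hkM) f f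
    rw [hs A hA] at this
    rw [← this, ← Ex_div]
    refine Ex_congr _ fun B _ => ?_
    rw [div_mul_div_comm]
  rw [Ex_congr _ hin]
  simp only [Ex_div, Ex_add, Ex_sub, Ex_mul_left, h1, h2]
  have kN : (N : ℝ) ≠ 0 := by positivity
  have kN1 : (N : ℝ) - 1 ≠ 0 := by
    have : (2 : ℝ) ≤ N := by exact_mod_cast hN
    linarith
  have kk : (k : ℝ) ≠ 0 := by positivity
  have kM : (M : ℝ) ≠ 0 := by positivity
  rcases Nat.lt_or_ge M 2 with h | h
  · obtain rfl : M = 1 := by omega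
    obtain rfl : k = 1 := by omega
    simp
    field_simp
  · have kM1 : (M : ℝ) - 1 ≠ 0 := by
      have : (2 : ℝ) ≤ M := by exact_mod_cast h
      linarith
    field_simp
    ring

/-- the gain-score estimator τ̂* = (ȳ(1) - x̄(1)) - (ȳ(0) - x̄(0))
is unbiased for τ and has variance
Var(τ̂*) = Var(τ̂) + (1/nx₁ + 1/nx₀)·Sₓ² - 2(S₁ₓ/N₁ + S₀ₓ/N₀),
where Var(τ̂) = S₁²/n₁ + S₀²/n₀ - S_τ²/N and N₀ = N - N₁. -/
theorem design3_gain_score_estimator (N N1 n1 n0 nx1 nx0 : ℕ)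
    (hN : 2 ≤ N) (hN1 : 1 ≤ N1) (hN0 : 1 ≤ N - N1) (hN1' : N1 ≤ N)
    (hn1 : 1 ≤ n1) (hn1' : n1 ≤ N1) (hn0 : 1 ≤ n0) (hn0' : n0 ≤ N - N1)
    (hnx1 : 1 ≤ nx1) (hnx1' : nx1 ≤ N1) (hnx0 : 1 ≤ nx0) (hnx0' : nx0 ≤ N - N1)
    (Y1 Y0 X : Fin N → ℝ) (Ybar1 Ybar0 Xbar S1sq S0sq Stausq Sxsq S1x S0x : ℝ)
    (hY1 : Ybar1 = (∑ i, Y1 i) / (N : ℝ))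
    (hY0 : Ybar0 = (∑ i, Y0 i) / (N : ℝ))
    (hX : Xbar = (∑ i, X i) / (N : ℝ))
    (hS1 : S1sq = (∑ i, (Y1 i - Ybar1) ^ 2) / ((N : ℝ) - 1))
    (hS0 : S0sq = (∑ i, (Y0 i - Ybar0) ^ 2) / ((N : ℝ) - 1))
    (hStau : Stausq =
      (∑ i, ((Y1 i - Y0 i) - (Ybar1 - Ybar0)) ^ 2) / ((N : ℝ) - 1))
    (hSx : Sxsq = (∑ i, (X i - Xbar) ^ 2) / ((N : ℝ) - 1))
    (hS1x : S1x = (∑ i, (Y1 i - Ybar1) * (X i - Xbar)) / ((N : ℝ) - 1))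
    (hS0x : S0x = (∑ i, (Y0 i - Ybar0) * (X i - Xbar)) / ((N : ℝ) - 1)) :
    (Ex (design3 N N1 n1 n0 nx1 nx0)
        (fun p => ((∑ i ∈ p.2.1, Y1 i) / (n1 : ℝ)
            - (∑ i ∈ p.2.2.2.1, X i) / (nx1 : ℝ))
          - ((∑ i ∈ p.2.2.1, Y0 i) / (n0 : ℝ)
            - (∑ i ∈ p.2.2.2.2, X i) / (nx0 : ℝ)))
      = (∑ i, (Y1 i - Y0 i)) / (N : ℝ)) ∧
    (Ex (design3 N N1 n1 n0 nx1 nx0)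
        (fun p => (((∑ i ∈ p.2.1, Y1 i) / (n1 : ℝ)
            - (∑ i ∈ p.2.2.2.1, X i) / (nx1 : ℝ))
          - ((∑ i ∈ p.2.2.1, Y0 i) / (n0 : ℝ)
            - (∑ i ∈ p.2.2.2.2, X i) / (nx0 : ℝ))) ^ 2)
      - (Ex (design3 N N1 n1 n0 nx1 nx0)
          (fun p => ((∑ i ∈ p.2.1, Y1 i) / (n1 : ℝ)
              - (∑ i ∈ p.2.2.2.1, X i) / (nx1 : ℝ))
            - ((∑ i ∈ p.2.2.1, Y0 i) / (n0 : ℝ)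
              - (∑ i ∈ p.2.2.2.2, X i) / (nx0 : ℝ)))) ^ 2
      = (S1sq / (n1 : ℝ) + S0sq / (n0 : ℝ) - Stausq / (N : ℝ))
        + (1 / (nx1 : ℝ) + 1 / (nx0 : ℝ)) * Sxsq
        - 2 * (S1x / (N1 : ℝ) + S0x / ((N : ℝ) - (N1 : ℝ)))) := by
  have hN0pos : N1 < N := by omega
  have kN : (N : ℝ) ≠ 0 := by positivity
  have kN1 : (N : ℝ) - 1 ≠ 0 := by
    have : (2 : ℝ) ≤ N := by exact_mod_cast hN
    linarith
  have kM : (N1 : ℝ) ≠ 0 := by positivity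
  have kM0 : (N : ℝ) - N1 ≠ 0 := by
    have : (N1 : ℝ) < N := by exact_mod_cast hN0pos
    linarith
  have kn1 : (n1 : ℝ) ≠ 0 := by positivity
  have kn0 : (n0 : ℝ) ≠ 0 := by positivity
  have knx1 : (nx1 : ℝ) ≠ 0 := by positivity
  have knx0 : (nx0 : ℝ) ≠ 0 := by positivity
  have castM0 : ((N - N1 : ℕ) : ℝ) = (N : ℝ) - N1 := by rw [Nat.cast_sub hN1']
  set Ω := design3 N N1 n1 n0 nx1 nx0 with hΩ
  set PA := powersetCard N1 (univ : Finset (Fin N)) with hPA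
  -- centered variables
  obtain ⟨y1, hy1⟩ : ∃ y : Fin N → ℝ, y = fun i => Y1 i - Ybar1 := ⟨_, rfl⟩
  obtain ⟨y0, hy0⟩ : ∃ y : Fin N → ℝ, y = fun i => Y0 i - Ybar0 := ⟨_, rfl⟩
  obtain ⟨x, hx⟩ : ∃ y : Fin N → ℝ, y = fun i => X i - Xbar := ⟨_, rfl⟩
  have z1 : ∑ i, y1 i = 0 := by
    simp [hy1, sum_sub_distrib, hY1]; field_simp; ring
  have z0 : ∑ i, y0 i = 0 := by
    simp [hy0, sum_sub_distrib, hY0]; field_simp; ring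
  have zx : ∑ i, x i = 0 := by
    simp [hx, sum_sub_distrib, hX]; field_simp; ring
  -- first-stage facts
  have cA : ∀ A ∈ PA, A.card = N1 := fun A hA => (mem_powersetCard.1 hA).2
  have cAc : ∀ A ∈ PA, Aᶜ.card = N - N1 := fun A hA => by
    rw [card_compl, cA A hA, Fintype.card_fin]
  have hPAne : PA.Nonempty := powersetCard_nonempty.2 (by simpa using hN1')
  have compl_sum : ∀ (f : Fin N → ℝ) (A : Finset (Fin N)),
      ∑ i ∈ Aᶜ, f i = ∑ i, f i - ∑ i ∈ A, f i := by
    intro f A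
    rw [← sum_add_sum_compl A f]; ring
  have E1 : ∀ f : Fin N → ℝ, Ex PA (fun A => ∑ i ∈ A, f i) = (N1 : ℝ) / N * ∑ i, f i := by
    intro f
    have := Ex_S (univ : Finset (Fin N)) N1 hN1 (by simpa using hN1') f
    simpa using this
  have E2 : ∀ f g : Fin N → ℝ, ∑ i, f i = 0 →
      Ex PA (fun A => (∑ i ∈ A, f i) * (∑ i ∈ A, g i))
        = (N1 : ℝ) * (N - N1) / (N * (N - 1)) * ∑ i, f i * g i := by
    intro f g hf
    have := Ex_SS (univ : Finset (Fin N)) N1 hN1 (by simpa using hN1') f g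
    rw [hf, card_univ, Fintype.card_fin] at this
    rw [this]
    field_simp
    ring
  have V1 : ∀ (f : Fin N → ℝ) (k : ℕ), ∑ i, f i = 0 → 1 ≤ k → k ≤ N1 →
      Ex PA (fun A => Ex (powersetCard k A)
        (fun B => ((∑ i ∈ B, f i) / (k : ℝ)) * ((∑ i ∈ B, f i) / (k : ℝ))))
      = (1 / (k : ℝ) - 1 / N) * ((∑ i, f i * f i) / (N - 1)) := by
    intro f k hf hk hk'
    exact two_stage N N1 N1 k hN hN1 hk hk' _ f (fun A => A) cA (E1 _) (E2 f f hf)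
  have V0 : ∀ (f : Fin N → ℝ) (k : ℕ), ∑ i, f i = 0 → 1 ≤ k → k ≤ N - N1 →
      Ex PA (fun A => Ex (powersetCard k Aᶜ)
        (fun B => ((∑ i ∈ B, f i) / (k : ℝ)) * ((∑ i ∈ B, f i) / (k : ℝ))))
      = (1 / (k : ℝ) - 1 / N) * ((∑ i, f i * f i) / (N - 1)) := by
    intro f k hf hk hk'
    refine two_stage N N1 (N - N1) k hN hN0 hk hk' _ f (fun A => Aᶜ) cAc ?_ ?_
    · simp only [compl_sum]
      rw [Ex_sub, ← hPA, E1, Ex_const _ hPAne, castM0]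
      field_simp
    · simp only [compl_sum, hf, zero_sub, neg_mul_neg]
      rw [← hPA, E2 f f hf, castM0]
      ring
  have m1 : ∀ (f : Fin N → ℝ) (k : ℕ), 1 ≤ k → k ≤ N1 → ∀ A ∈ PA,
      Ex (powersetCard k A) (fun B => (∑ i ∈ B, f i) / (k : ℝ)) = (∑ i ∈ A, f i) / N1 := by
    intro f k hk hk' A hA
    have hk0 : (k : ℝ) ≠ 0 := by positivity
    rw [Ex_div, Ex_S A k hk (by rw [cA A hA]; exact hk'), cA A hA]
    field_simp
  have m0 : ∀ (f : Fin N → ℝ) (k : ℕ), ∑ i, f i = 0 → 1 ≤ k → k ≤ N - N1 → ∀ A ∈ PA,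
      Ex (powersetCard k Aᶜ) (fun B => (∑ i ∈ B, f i) / (k : ℝ))
        = -(∑ i ∈ A, f i) / ((N : ℝ) - N1) := by
    intro f k hf hk hk' A hA
    have hk0 : (k : ℝ) ≠ 0 := by positivity
    rw [Ex_div, Ex_S Aᶜ k hk (by rw [cAc A hA]; exact hk'), cAc A hA, castM0, compl_sum, hf]
    field_simp
    ring
  -- the centered estimator
  obtain ⟨D, hD⟩ : ∃ D : Finset (Fin N) × Finset (Fin N) × Finset (Fin N) ×
      Finset (Fin N) × Finset (Fin N) → ℝ, D = fun p =>
        ((∑ i ∈ p.2.1, y1 i) / (n1 : ℝ) - (∑ i ∈ p.2.2.2.1, x i) / (nx1 : ℝ))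
          - ((∑ i ∈ p.2.2.1, y0 i) / (n0 : ℝ) - (∑ i ∈ p.2.2.2.2, x i) / (nx0 : ℝ)) := ⟨_, rfl⟩
  have hne : ∀ A ∈ PA, (powersetCard n1 A).Nonempty ∧ (powersetCard n0 Aᶜ).Nonempty ∧
      (powersetCard nx1 A).Nonempty ∧ (powersetCard nx0 Aᶜ).Nonempty := by
    intro A hA
    simp only [powersetCard_nonempty, cA A hA, cAc A hA]
    exact ⟨hn1', hn0', hnx1', hnx0'⟩
  have hΩne : Ω.Nonempty := by
    obtain ⟨A, hA⟩ := hPAne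
    obtain ⟨⟨B, hB⟩, ⟨C, hC⟩, ⟨Bx, hBx⟩, ⟨Cx, hCx⟩⟩ := hne A hA
    have hcA := cA A hA
    refine ⟨(A, B, C, Bx, Cx), ?_⟩
    rw [mem_powersetCard] at hB hC hBx hCx
    simp only [hΩ, design3, mem_filter, mem_univ, true_and]
    tauto
  have hED : Ex Ω D = 0 := by
    rw [hΩ, Ex_design3, ← hPA]
    have : ∀ A ∈ PA, Ex (powersetCard n1 A) (fun B =>
        Ex (powersetCard n0 Aᶜ) (fun C => Ex (powersetCard nx1 A) (fun Bx =>
          Ex (powersetCard nx0 Aᶜ) (fun Cx => D (A, B, C, Bx, Cx)))))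
        = ((∑ i ∈ A, y1 i) / N1 - (∑ i ∈ A, x i) / N1)
          - ((∑ i ∈ A, y0 i) * (-1 / ((N : ℝ) - N1)) - (∑ i ∈ A, x i) * (-1 / ((N : ℝ) - N1))) := by
      intro A hA
      obtain ⟨a1, a2, a3, a4⟩ := hne A hA
      rw [hD]
      refine (Ex_four _ _ _ _ a1 a2 a3 a4 (fun B => (∑ i ∈ B, y1 i) / (n1 : ℝ))
        (fun B => (∑ i ∈ B, x i) / (nx1 : ℝ)) (fun B => (∑ i ∈ B, y0 i) / (n0 : ℝ))
        (fun B => (∑ i ∈ B, x i) / (nx0 : ℝ))).trans ?_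
      rw [m1 y1 n1 hn1 hn1' A hA, m1 x nx1 hnx1 hnx1' A hA, m0 y0 n0 z0 hn0 hn0' A hA,
        m0 x nx0 zx hnx0 hnx0' A hA]
      ring
    rw [Ex_congr _ this]
    simp only [Ex_sub, Ex_div, Ex_mul_right, E1, z1, z0, zx]
    ring
  have hED2 : Ex Ω (fun p => D p ^ 2) =
      (1 / (n1 : ℝ) - 1 / N) * ((∑ i, y1 i * y1 i) / (N - 1))
      + (1 / (nx1 : ℝ) - 1 / N) * ((∑ i, x i * x i) / (N - 1))
      + (1 / (n0 : ℝ) - 1 / N) * ((∑ i, y0 i * y0 i) / (N - 1))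
      + (1 / (nx0 : ℝ) - 1 / N) * ((∑ i, x i * x i) / (N - 1))
      + (-2 / (N1 * N1) - 2 / (N1 * (N - N1))) *
          ((N1 : ℝ) * (N - N1) / (N * (N - 1)) * ∑ i, y1 i * x i)
      + 2 / (N1 * (N - N1)) * ((N1 : ℝ) * (N - N1) / (N * (N - 1)) * ∑ i, y1 i * y0 i)
      + (-2 / (N1 * (N - N1)) - 2 / ((N - N1) * (N - N1))) *
          ((N1 : ℝ) * (N - N1) / (N * (N - 1)) * ∑ i, y0 i * x i)
      + 2 / (N1 * (N - N1)) * ((N1 : ℝ) * (N - N1) / (N * (N - 1)) * ∑ i, x i * x i) := by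
    rw [hΩ, Ex_design3, ← hPA]
    rw [← V1 y1 n1 z1 hn1 hn1', ← V1 x nx1 zx hnx1 hnx1', ← V0 y0 n0 z0 hn0 hn0',
      ← V0 x nx0 zx hnx0 hnx0', ← E2 y1 x z1, ← E2 y1 y0 z1, ← E2 y0 x z0, ← E2 x x zx]
    simp only [← Ex_mul_left, ← Ex_add]
    refine Ex_congr _ fun A hA => ?_
    obtain ⟨a1, a2, a3, a4⟩ := hne A hA
    rw [hD]
    refine (Ex_four_sq _ _ _ _ a1 a2 a3 a4 (fun B => (∑ i ∈ B, y1 i) / (n1 : ℝ))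
      (fun B => (∑ i ∈ B, x i) / (nx1 : ℝ)) (fun B => (∑ i ∈ B, y0 i) / (n0 : ℝ))
      (fun B => (∑ i ∈ B, x i) / (nx0 : ℝ))).trans ?_
    rw [m1 y1 n1 hn1 hn1' A hA, m1 x nx1 hnx1 hnx1' A hA, m0 y0 n0 z0 hn0 hn0' A hA,
      m0 x nx0 zx hnx0 hnx0' A hA]
    simp only [div_eq_mul_inv, mul_inv]
    ring
  have hpt : ∀ p ∈ Ω, ((∑ i ∈ p.2.1, Y1 i) / (n1 : ℝ)
            - (∑ i ∈ p.2.2.2.1, X i) / (nx1 : ℝ))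
          - ((∑ i ∈ p.2.2.1, Y0 i) / (n0 : ℝ)
            - (∑ i ∈ p.2.2.2.2, X i) / (nx0 : ℝ)) = D p + (Ybar1 - Ybar0) := by
    rintro ⟨A, B, C, Bx, Cx⟩ hp
    simp only [hΩ, design3, mem_filter, mem_univ, true_and] at hp
    obtain ⟨-, -, hB, -, hC, -, hBx, -, hCx⟩ := hp
    simp only [hD, hy1, hy0, hx, sum_sub_distrib, sum_const, nsmul_eq_mul, hB, hC, hBx, hCx]
    field_simp
    ring
  have hE : Ex Ω (fun p => ((∑ i ∈ p.2.1, Y1 i) / (n1 : ℝ)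
            - (∑ i ∈ p.2.2.2.1, X i) / (nx1 : ℝ))
          - ((∑ i ∈ p.2.2.1, Y0 i) / (n0 : ℝ)
            - (∑ i ∈ p.2.2.2.2, X i) / (nx0 : ℝ))) = Ybar1 - Ybar0 := by
    rw [Ex_congr _ hpt, Ex_add, Ex_const _ hΩne, hED, zero_add]
  refine ⟨?_, ?_⟩
  · rw [hE, hY1, hY0, sum_sub_distrib, sub_div]
  · rw [hE]
    have hsq : Ex Ω (fun p => (((∑ i ∈ p.2.1, Y1 i) / (n1 : ℝ)
            - (∑ i ∈ p.2.2.2.1, X i) / (nx1 : ℝ))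
          - ((∑ i ∈ p.2.2.1, Y0 i) / (n0 : ℝ)
            - (∑ i ∈ p.2.2.2.2, X i) / (nx0 : ℝ))) ^ 2)
        = Ex Ω (fun p => D p ^ 2) + (Ybar1 - Ybar0) ^ 2 := by
      have : ∀ p ∈ Ω, (((∑ i ∈ p.2.1, Y1 i) / (n1 : ℝ)
            - (∑ i ∈ p.2.2.2.1, X i) / (nx1 : ℝ))
          - ((∑ i ∈ p.2.2.1, Y0 i) / (n0 : ℝ)
            - (∑ i ∈ p.2.2.2.2, X i) / (nx0 : ℝ))) ^ 2
          = D p ^ 2 + 2 * (Ybar1 - Ybar0) * D p + (Ybar1 - Ybar0) ^ 2 := by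
        intro p hp
        rw [hpt p hp]; ring
      rw [Ex_congr _ this, Ex_add, Ex_add, Ex_mul_left, Ex_const _ hΩne, hED]
      ring
    rw [hsq, hED2]
    have q1 : S1sq = (∑ i, y1 i * y1 i) / ((N : ℝ) - 1) := by
      rw [hS1, hy1]; simp only [sq]
    have q0 : S0sq = (∑ i, y0 i * y0 i) / ((N : ℝ) - 1) := by
      rw [hS0, hy0]; simp only [sq]
    have qx : Sxsq = (∑ i, x i * x i) / ((N : ℝ) - 1) := by
      rw [hSx, hx]; simp only [sq]
    have q1x : S1x = (∑ i, y1 i * x i) / ((N : ℝ) - 1) := by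
      rw [hS1x, hy1, hx]
    have q0x : S0x = (∑ i, y0 i * x i) / ((N : ℝ) - 1) := by
      rw [hS0x, hy0, hx]
    have qt : Stausq = ((∑ i, y1 i * y1 i) + (∑ i, y0 i * y0 i)
        - 2 * ∑ i, y1 i * y0 i) / ((N : ℝ) - 1) := by
      rw [hStau, mul_sum, ← sum_add_distrib, ← sum_sub_distrib, hy1, hy0]
      congr 1
      refine sum_congr rfl fun i _ => ?_
      ring
    rw [q1, q0, qx, q1x, q0x, qt]
    generalize ∑ i, y1 i * y1 i = A1
    generalize ∑ i, y0 i * y0 i = A2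
    generalize ∑ i, x i * x i = A3
    generalize ∑ i, y1 i * x i = A4
    generalize ∑ i, y0 i * x i = A5
    generalize ∑ i, y1 i * y0 i = A6
    field_simp
    ring
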